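/- For every ε > 0 there exists δ > 0 such that for all s, t ∈ ℝ satisfying s ≤ π − ε ≤ t − 2ε ≤ s − 3ε + π (equivalently s ≤ π − ε, t ≥ π + ε, t ≤ s + π − ε; these conditions force 0 < s < π < t < s + π), the operator norm of sgn Q(0) + sgn Q(s) + sgn Q(t) on L²(ℝ) is at most 3 − δ. -/

import Mathlib

open MeasureTheory Complex Real
open scoped InnerProductSpace ComplexConjugate

noncomputable section

/-- The complex Hilbert space `L²(ℝ, ℂ)`. -/
abbrev L2 : Type := Lp ℂ 2 (volume : Measure ℝ)

/-- `F` is the Fourier–Plancherel unitary operator on `L²(ℝ)`,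
with convention `(Fψ)(p) = (2π)^{-1/2} ∫ e^{-ipq} ψ(q) dq`
(this property on the dense subspace `L¹ ∩ L²` determines `F` uniquely). -/
def IsFourier (F : L2 ≃ₗᵢ[ℂ] L2) : Prop :=
  ∀ ψ : L2, Integrable (⇑ψ) volume →
    (F ψ : ℝ → ℂ) =ᵐ[volume]
      fun p : ℝ => (((2 * π) ^ (-(1:ℝ)/2) : ℝ) : ℂ) *
        ∫ q : ℝ, Complex.exp (-(Complex.I) * (p : ℂ) * (q : ℂ)) * ψ q

/-- `T` is the bounded multiplication operator `M_g` by `g` on `L²(ℝ)`. -/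
def IsMulOp (g : ℝ → ℂ) (T : L2 →L[ℂ] L2) : Prop :=
  ∀ ψ : L2, (T ψ : ℝ → ℂ) =ᵐ[volume] fun q => g q * ψ q

/-- `T = sgn P := 𝓕⁻¹ ∘ M_sgn ∘ 𝓕`. -/
def IsSgnP (T : L2 →L[ℂ] L2) : Prop :=
  ∃ F : L2 ≃ₗᵢ[ℂ] L2, IsFourier F ∧
    ∀ ψ : L2, (F (T ψ) : ℝ → ℂ) =ᵐ[volume]
      fun p => ((Real.sign p : ℝ) : ℂ) * (F ψ : ℝ → ℂ) p

/-- `χ_t(q) = exp(−(i/2)(cot t) q²)`. -/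
def chi (t q : ℝ) : ℂ :=
  Complex.exp (-(Complex.I / 2) * ((Real.cos t / Real.sin t : ℝ) : ℂ) * (q : ℂ) ^ 2)

/-- `T = sgn Q(t)`: for `t = 0` this is `M_sgn`, and for `sin t ≠ 0` it is
`sgn(sin t) · M_{χ_t} ∘ (sgn P) ∘ M_{χ_t}⁻¹`, which realizes `sgn(Q cos t + P sin t)`. -/
def IsSgnQ (t : ℝ) (T : L2 →L[ℂ] L2) : Prop :=
  if t = 0 then IsMulOp (fun q => ((Real.sign q : ℝ) : ℂ)) T
  else ∃ P Mc Mci : L2 →L[ℂ] L2, IsSgnP P ∧ IsMulOp (chi t) Mc ∧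
    IsMulOp (fun q => (chi t q)⁻¹) Mci ∧
    T = (((Real.sign (Real.sin t) : ℝ) : ℂ) • (Mc ∘L P ∘L Mci))

/-- The weight of the Schur test on the half line. -/
def schurWeight (x y : ℝ) : ℝ :=
  |√x - √y| * √x / (√y * ((√x + √y) * (x + y)))

lemma hasDerivAt_log_sqrt {x y : ℝ} (hx : 0 < x) (hy : 0 < y) :
    HasDerivAt (fun y => 2 * Real.log (√x + √y) - Real.log (x + y))
      ((√x - √y) * √x / (√y * ((√x + √y) * (x + y)))) y := by
  have h1 : 0 < √x := Real.sqrt_pos.2 hx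
  have h2 : 0 < √y := Real.sqrt_pos.2 hy
  have h3 := (((hasDerivAt_id y).sqrt hy.ne').const_add (√x)).log (by simpa using (by positivity : √x + √y ≠ 0))
  have h4 := ((hasDerivAt_id y).const_add x).log (by simpa using (by positivity : x + y ≠ 0))
  refine ((h3.const_mul 2).sub h4).congr_deriv ?_
  have e1 : x = √x ^ 2 := (Real.sq_sqrt hx.le).symm
  have e2 : y = √y ^ 2 := (Real.sq_sqrt hy.le).symm
  simp only [id]
  generalize √x = a at *
  generalize √y = b at *
  subst e1 e2
  field_simp
  ring

lemma continuousOn_log_sqrt {x : ℝ} (hx : 0 < x) :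
    ContinuousOn (fun y => 2 * Real.log (√x + √y) - Real.log (x + y)) (Set.Ici 0) := by
  have h1 : 0 < √x := Real.sqrt_pos.2 hx
  refine ContinuousOn.sub (continuousOn_const.mul (ContinuousOn.log (by fun_prop) ?_))
    (ContinuousOn.log (by fun_prop) ?_)
  · intro y _; positivity
  · intro y (hy : 0 ≤ y); positivity

lemma tendsto_log_sqrt {x : ℝ} (hx : 0 < x) :
    Filter.Tendsto (fun y => 2 * Real.log (√x + √y) - Real.log (x + y))
      Filter.atTop (nhds 0) := by
  have h0 : Filter.Tendsto (fun y : ℝ => (√y)⁻¹) Filter.atTop (nhds 0) :=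
    tendsto_inv_atTop_zero.comp Real.tendsto_sqrt_atTop
  have h1 : Filter.Tendsto (fun y : ℝ => 2 * Real.log (√x * (√y)⁻¹ + 1)
      - Real.log (x * ((√y)⁻¹) ^ 2 + 1)) Filter.atTop
      (nhds (2 * Real.log (√x * 0 + 1) - Real.log (x * 0 ^ 2 + 1))) := by
    refine Filter.Tendsto.sub (Filter.Tendsto.const_mul _ (Filter.Tendsto.log ?_ (by norm_num)))
      (Filter.Tendsto.log ?_ (by norm_num))
    · exact (h0.const_mul _).add_const _
    · exact ((h0.pow 2).const_mul _).add_const _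
  simp only [mul_zero, zero_add, Real.log_one, sub_zero, ne_eq, OfNat.ofNat_ne_zero,
    not_false_eq_true, zero_pow] at h1
  refine h1.congr' ?_
  filter_upwards [Filter.eventually_gt_atTop 0] with y hy
  have h1 : 0 < √x := Real.sqrt_pos.2 hx
  have h2 : 0 < √y := Real.sqrt_pos.2 hy
  have e1 : √x + √y = √y * (√x * (√y)⁻¹ + 1) := by field_simp
  have e2 : x + y = √y * √y * (x * ((√y)⁻¹) ^ 2 + 1) := by
    rw [Real.mul_self_sqrt hy.le, inv_pow, Real.sq_sqrt hy.le]; field_simp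
  rw [e1, e2, Real.log_mul (by positivity) (by positivity), Real.log_mul (by positivity) (by positivity),
    Real.log_mul (by positivity) (by positivity)]
  ring

lemma integrableOn_and_integral_schurWeight {x : ℝ} (hx : 0 < x) :
    IntegrableOn (schurWeight x) (Set.Ioi 0) ∧
      ∫ y in Set.Ioi 0, schurWeight x y = 2 * Real.log 2 := by
  set g : ℝ → ℝ := fun y => 2 * Real.log (√x + √y) - Real.log (x + y) with hg
  set g' : ℝ → ℝ := fun y => (√x - √y) * √x / (√y * ((√x + √y) * (x + y))) with hg'
  have hsx : 0 < √x := Real.sqrt_pos.2 hx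
  have hcont := continuousOn_log_sqrt hx
  have hd : ∀ y, 0 < y → HasDerivAt g (g' y) y := fun y hy => hasDerivAt_log_sqrt hx hy
  have hpos : ∀ y ∈ Set.Ioo 0 x, 0 ≤ g' y := fun y hy => by
    have := Real.sqrt_le_sqrt hy.2.le
    have h3 := hy.1
    exact div_nonneg (mul_nonneg (by linarith) hsx.le) (by positivity)
  have hneg : ∀ y ∈ Set.Ioi x, g' y ≤ 0 := fun y (hy : x < y) => by
    have := Real.sqrt_le_sqrt hy.le
    have h3 : 0 < y := hx.trans hy
    exact div_nonpos_of_nonpos_of_nonneg (mul_nonpos_of_nonpos_of_nonneg (by linarith) hsx.le)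
      (by positivity)
  have e1 : Set.EqOn g' (schurWeight x) (Set.Ioc 0 x) := fun y hy => by
    have := Real.sqrt_le_sqrt hy.2
    simp [hg', schurWeight, abs_of_nonneg (sub_nonneg.2 this)]
  have e2 : Set.EqOn (fun y => - g' y) (schurWeight x) (Set.Ioi x) := fun y hy => by
    have := Real.sqrt_le_sqrt (le_of_lt hy)
    simp only [hg', schurWeight, abs_of_nonpos (sub_nonpos.2 this)]
    ring
  have hc1 : ContinuousOn g (Set.Icc 0 x) := hcont.mono Set.Icc_subset_Ici_self
  have i1 : IntegrableOn g' (Set.Ioc 0 x) :=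
    intervalIntegral.integrableOn_deriv_of_nonneg hc1 (fun y hy => hd y hy.1) hpos
  have hcx : ContinuousWithinAt g (Set.Ici x) x := (hd x hx).continuousAt.continuousWithinAt
  have i2 : IntegrableOn g' (Set.Ioi x) :=
    integrableOn_Ioi_deriv_of_nonpos hcx (fun y hy => hd y (hx.trans hy)) hneg (tendsto_log_sqrt hx)
  have v1 : ∫ y in Set.Ioc 0 x, g' y = g x - g 0 := by
    rw [← intervalIntegral.integral_of_le hx.le]
    refine intervalIntegral.integral_eq_sub_of_hasDerivAt_of_le hx.le hc1 (fun y hy => hd y hy.1) ?_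
    rwa [intervalIntegrable_iff_integrableOn_Ioc_of_le hx.le]
  have v2 : ∫ y in Set.Ioi x, g' y = 0 - g x :=
    integral_Ioi_of_hasDerivAt_of_nonpos hcx (fun y hy => hd y (hx.trans hy)) hneg
      (tendsto_log_sqrt hx)
  have g0 : g 0 = 0 := by
    have : Real.log x = 2 * Real.log (√x) := by
      rw [Real.log_sqrt hx.le]; ring
    simp [hg, this]
  have gx : g x = Real.log 2 := by
    have h1 : Real.log x = 2 * Real.log (√x) := by
      rw [Real.log_sqrt hx.le]; ring
    simp only [hg, ← two_mul]
    rw [Real.log_mul (by norm_num) hsx.ne', Real.log_mul (by norm_num) hx.ne', h1]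
    ring
  have j1 : IntegrableOn (schurWeight x) (Set.Ioc 0 x) := i1.congr_fun e1 measurableSet_Ioc
  have j2 : IntegrableOn (schurWeight x) (Set.Ioi x) := i2.neg.congr_fun e2 measurableSet_Ioi
  rw [← Set.Ioc_union_Ioi_eq_Ioi hx.le]
  refine ⟨j1.union j2, ?_⟩
  rw [setIntegral_union (Set.Ioc_disjoint_Ioi le_rfl) measurableSet_Ioi j1 j2,
    ← setIntegral_congr_fun measurableSet_Ioc e1, ← setIntegral_congr_fun measurableSet_Ioi e2,
    v1, integral_neg, v2, g0, gx]
  ring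

lemma integrable_comp_abs_of_integrableOn {f : ℝ → ℝ} (hf : IntegrableOn f (Set.Ioi 0)) :
    Integrable (fun x => f |x|) := by
  have h1 : IntegrableOn (fun x => f |x|) (Set.Ioi 0) :=
    hf.congr_fun (fun x (hx : 0 < x) => by simp [abs_of_pos hx]) measurableSet_Ioi
  have h2 : IntegrableOn (fun x => f |x|) (Set.Iic 0) := by
    rw [← integrableOn_Ici_iff_integrableOn_Ioi, ← neg_zero] at h1
    simpa using IntegrableOn.comp_neg_Iic (c := 0) h1
  rw [← integrableOn_univ, ← Set.Iic_union_Ioi (a := (0 : ℝ))]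
  exact h2.union h1

lemma integrable_and_integral_schurWeight_abs {x : ℝ} (hx : x ≠ 0) :
    Integrable (fun y : ℝ => schurWeight |x| |y|) ∧
      ∫ y : ℝ, schurWeight |x| |y| = 4 * Real.log 2 := by
  obtain ⟨h1, h2⟩ := integrableOn_and_integral_schurWeight (abs_pos.2 hx)
  refine ⟨?_, ?_⟩
  · exact integrable_comp_abs_of_integrableOn h1
  · rw [integral_comp_abs (f := schurWeight |x|), h2]; ring

lemma schurWeight_nonneg {x y : ℝ} (hx : 0 ≤ x) (hy : 0 ≤ y) : 0 ≤ schurWeight x y := by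
  unfold schurWeight; positivity

lemma measurable_schurWeight :
    Measurable (fun z : ℝ × ℝ => schurWeight |z.1| |z.2|) := by
  unfold schurWeight
  fun_prop

lemma integrable_mul_schurWeight {a : ℝ → ℝ} (ha : Integrable a) (ha0 : ∀ x, 0 ≤ a x) :
    Integrable (fun z : ℝ × ℝ => a z.1 * schurWeight |z.1| |z.2|)
      ((volume : Measure ℝ).prod volume) ∧
      ∫ z : ℝ × ℝ, a z.1 * schurWeight |z.1| |z.2| ∂((volume : Measure ℝ).prod volume) =
        4 * Real.log 2 * ∫ x, a x := by
  have hae : ∀ᵐ x : ℝ, x ≠ 0 := by simp [ae_iff]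
  have hI : ∀ᵐ x : ℝ, ∫ y : ℝ, a x * schurWeight |x| |y| = 4 * Real.log 2 * a x := by
    filter_upwards [hae] with x hx
    rw [integral_const_mul, (integrable_and_integral_schurWeight_abs hx).2]; ring
  have hint : Integrable (fun z : ℝ × ℝ => a z.1 * schurWeight |z.1| |z.2|)
      ((volume : Measure ℝ).prod volume) := by
    have hm : AEStronglyMeasurable (fun z : ℝ × ℝ => a z.1 * schurWeight |z.1| |z.2|)
        ((volume : Measure ℝ).prod volume) :=
      ha.aestronglyMeasurable.comp_fst.mul measurable_schurWeight.aestronglyMeasurable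
    rw [integrable_prod_iff hm]
    refine ⟨?_, ?_⟩
    · filter_upwards [hae] with x hx
      exact (integrable_and_integral_schurWeight_abs hx).1.const_mul _
    · refine (ha.const_mul (4 * Real.log 2)).congr ?_
      filter_upwards [hI] with x hx
      rw [← hx]
      refine integral_congr_ae (.of_forall fun y => ?_)
      exact (Real.norm_of_nonneg (mul_nonneg (ha0 x)
        (schurWeight_nonneg (abs_nonneg _) (abs_nonneg _)))).symm
  refine ⟨hint, ?_⟩
  rw [integral_prod _ hint, integral_congr_ae hI, integral_const_mul]

/-- A bounded integral kernel, homogeneous of degree `-1`. -/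
def sqrtKernel (x y : ℝ) : ℝ := |√x - √y| / ((√x + √y) * (x + y))

/-- A Schur test. -/
lemma norm_integral_kernel_le {Φ : ℝ → ℂ} (hΦ : Integrable (fun x => ‖Φ x‖ ^ 2))
    {m : ℝ × ℝ → ℂ}
    (hm : ∀ z : ℝ × ℝ, ‖m z‖ ≤ sqrtKernel |z.1| |z.2|) :
    ‖∫ z : ℝ × ℝ, Φ z.1 * conj (Φ z.2) * m z ∂((volume : Measure ℝ).prod volume)‖
      ≤ 4 * Real.log 2 * ∫ x, ‖Φ x‖ ^ 2 := by
  obtain ⟨i1, v1⟩ := integrable_mul_schurWeight hΦ (fun x => by positivity)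
  have i2 := i1.swap
  have v2 := integral_prod_swap (μ := (volume : Measure ℝ)) (ν := (volume : Measure ℝ))
    (fun z : ℝ × ℝ => ‖Φ z.1‖ ^ 2 * schurWeight |z.1| |z.2|)
  rw [v1] at v2
  calc _ ≤ ∫ z : ℝ × ℝ, ‖Φ z.1 * conj (Φ z.2) * m z‖
        ∂((volume : Measure ℝ).prod volume) :=
        norm_integral_le_integral_norm _
    _ ≤ ∫ z : ℝ × ℝ, (1 / 2 : ℝ) * (‖Φ z.1‖ ^ 2 * schurWeight |z.1| |z.2| +
        ‖Φ z.swap.1‖ ^ 2 * schurWeight |z.swap.1| |z.swap.2|)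
        ∂((volume : Measure ℝ).prod volume) := by
        refine integral_mono_of_nonneg (.of_forall fun z => norm_nonneg _)
          ((i1.add i2).const_mul _) ?_
        have h1 : ∀ᵐ z : ℝ × ℝ ∂((volume : Measure ℝ).prod volume), z.1 ≠ 0 :=
          Measure.quasiMeasurePreserving_fst.ae (p := fun x : ℝ => x ≠ 0) (by simp [ae_iff])
        have h2 : ∀ᵐ z : ℝ × ℝ ∂((volume : Measure ℝ).prod volume), z.2 ≠ 0 :=
          Measure.quasiMeasurePreserving_snd.ae (p := fun x : ℝ => x ≠ 0) (by simp [ae_iff])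
        filter_upwards [h1, h2] with z hz1 hz2
        have p1 : 0 < √|z.1| := Real.sqrt_pos.2 (abs_pos.2 hz1)
        have p2 : 0 < √|z.2| := Real.sqrt_pos.2 (abs_pos.2 hz2)
        have q1 : 0 < |z.1| := abs_pos.2 hz1
        have q2 : 0 < |z.2| := abs_pos.2 hz2
        rw [norm_mul, norm_mul, RCLike.norm_conj]
        refine (mul_le_mul_of_nonneg_left (hm z) (by positivity)).trans ?_
        simp only [sqrtKernel, schurWeight, Prod.fst_swap, Prod.snd_swap]
        rw [abs_sub_comm (√|z.2|) (√|z.1|), add_comm (√|z.2|) (√|z.1|), add_comm |z.2| |z.1|]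
        have key : ‖Φ z.1‖ * ‖Φ z.2‖ ≤
            1 / 2 * (‖Φ z.1‖ ^ 2 * (√|z.1| / √|z.2|) + ‖Φ z.2‖ ^ 2 * (√|z.2| / √|z.1|)) := by
          have : 1 / 2 * (‖Φ z.1‖ ^ 2 * (√|z.1| / √|z.2|) + ‖Φ z.2‖ ^ 2 * (√|z.2| / √|z.1|))
            - ‖Φ z.1‖ * ‖Φ z.2‖ =
            (‖Φ z.1‖ * √|z.1| - ‖Φ z.2‖ * √|z.2|) ^ 2 / (2 * (√|z.1| * √|z.2|)) := by
            field_simp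
            ring
          have h : 0 ≤ (‖Φ z.1‖ * √|z.1| - ‖Φ z.2‖ * √|z.2|) ^ 2 / (2 * (√|z.1| * √|z.2|)) := by
            positivity
          linarith
        refine (mul_le_mul_of_nonneg_right key (by positivity)).trans (le_of_eq ?_)
        field_simp
    _ = 4 * Real.log 2 * ∫ x, ‖Φ x‖ ^ 2 := by
        rw [integral_const_mul]
        have := integral_add i1 i2
        simp only [Function.comp_def] at this
        rw [this, v1, v2]
        ring

/-- Parseval-type identity for quadratic forms that are mixtures of squared moduli of
oscillatory integrals. -/
lemma integral_mul_normSq_oscillatory {f : ℝ → ℂ} (hf : Integrable f) {w : ℝ → ℂ}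
    (hw : Integrable w) {θ : ℝ → ℝ} (hθ : Continuous θ) :
    ∫ p : ℝ, w p * ((∫ q, Complex.exp (-Complex.I * p * θ q) * f q) *
        conj (∫ q, Complex.exp (-Complex.I * p * θ q) * f q)) =
      ∫ z : ℝ × ℝ, f z.1 * conj (f z.2) *
        (∫ p : ℝ, w p * Complex.exp (-Complex.I * p * ((θ z.1 - θ z.2 : ℝ) : ℂ)))
        ∂((volume : Measure ℝ).prod volume) := by
  have hconj : ∀ p q : ℝ, conj (Complex.exp (-Complex.I * p * θ q)) =
      Complex.exp (Complex.I * p * θ q) := fun p q => by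
    rw [← Complex.exp_conj]; simp
  have h1 : ∀ p : ℝ, w p * ((∫ q, Complex.exp (-Complex.I * p * θ q) * f q) *
        conj (∫ q, Complex.exp (-Complex.I * p * θ q) * f q)) =
      ∫ z : ℝ × ℝ, w p * (f z.1 * conj (f z.2)) *
        Complex.exp (-Complex.I * p * ((θ z.1 - θ z.2 : ℝ) : ℂ))
        ∂((volume : Measure ℝ).prod volume) := fun p => by
    rw [← integral_conj, ← integral_prod_mul, ← integral_const_mul]
    congr 1 with z
    rw [map_mul, hconj]
    have : Complex.exp (-Complex.I * p * ((θ z.1 - θ z.2 : ℝ) : ℂ)) =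
        Complex.exp (-Complex.I * p * θ z.1) * Complex.exp (Complex.I * p * θ z.2) := by
      rw [← Complex.exp_add]; push_cast; ring_nf
    rw [this]; ring
  have hint : Integrable (Function.uncurry fun (p : ℝ) (z : ℝ × ℝ) => w p * (f z.1 * conj (f z.2)) *
        Complex.exp (-Complex.I * p * ((θ z.1 - θ z.2 : ℝ) : ℂ)))
      ((volume : Measure ℝ).prod ((volume : Measure ℝ).prod volume)) := by
    have hff : Integrable (fun z : ℝ × ℝ => f z.1 * conj (f z.2))
        ((volume : Measure ℝ).prod volume) :=
      hf.mul_prod (((RCLike.conjCLE (K := ℂ)).toContinuousLinearMap).integrable_comp hf)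
    have h := hw.mul_prod hff
    refine (h.mul_bdd (c := 1) (g := fun v : ℝ × ℝ × ℝ =>
      Complex.exp (-Complex.I * v.1 * ((θ v.2.1 - θ v.2.2 : ℝ) : ℂ))) ?_ ?_)
    · exact Continuous.aestronglyMeasurable (by fun_prop)
    · refine .of_forall fun v => ?_
      rw [Complex.norm_exp]
      simp
  simp_rw [h1]
  rw [integral_integral_swap hint]
  congr 1 with z
  rw [← integral_const_mul]
  congr 1 with p
  ring

lemma measurable_sign : Measurable Real.sign := by
  unfold Real.sign
  exact Measurable.ite measurableSet_Iio measurable_const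
    (Measurable.ite measurableSet_Ioi measurable_const measurable_const)

lemma integrable_sign_mul_exp {η : ℝ} (hη : 0 < η) :
    Integrable (fun p : ℝ => ((Real.sign p * Real.exp (-η * |p|) : ℝ) : ℂ)) := by
  have h1 : Integrable (fun p : ℝ => Real.exp (-η * |p|)) :=
    integrable_comp_abs_of_integrableOn (f := fun p => Real.exp (-η * p))
      (integrableOn_exp_mul_Ioi (by linarith) 0)
  refine (h1.mono' (f := fun p : ℝ => Real.sign p * Real.exp (-η * |p|)) ?_ ?_).ofReal
  · exact (measurable_sign.mul (by fun_prop)).aestronglyMeasurable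
  · refine .of_forall fun p => ?_
    rw [norm_mul, Real.norm_of_nonneg (Real.exp_pos _).le]
    refine mul_le_of_le_one_left (Real.exp_pos _).le ?_
    obtain h | h | h := Real.sign_apply_eq p <;> simp [h]

lemma integral_sign_mul_exp {η : ℝ} (hη : 0 < η) (u : ℝ) :
    ∫ p : ℝ, ((Real.sign p * Real.exp (-η * |p|) : ℝ) : ℂ) * Complex.exp (-Complex.I * p * u) =
      -2 * Complex.I * u / (η ^ 2 + u ^ 2 : ℝ) := by
  have e1 : Set.EqOn (fun p : ℝ => Complex.exp ((-η - Complex.I * u) * p))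
      (fun p : ℝ => ((Real.sign p * Real.exp (-η * |p|) : ℝ) : ℂ) *
        Complex.exp (-Complex.I * p * u)) (Set.Ioi 0) := fun p (hp : 0 < p) => by
    simp only [Real.sign_of_pos hp, abs_of_pos hp]
    push_cast
    rw [one_mul, ← Complex.exp_add]
    ring_nf
  have e2 : Set.EqOn (fun p : ℝ => -Complex.exp ((η - Complex.I * u) * p))
      (fun p : ℝ => ((Real.sign p * Real.exp (-η * |p|) : ℝ) : ℂ) *
        Complex.exp (-Complex.I * p * u)) (Set.Iio 0) := fun p (hp : p < 0) => by
    simp only [Real.sign_of_neg hp, abs_of_neg hp]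
    push_cast
    rw [neg_one_mul, neg_mul, ← Complex.exp_add]
    ring_nf
  have i1 : (-η - Complex.I * u : ℂ).re < 0 := by simpa using hη
  have i2 : 0 < (η - Complex.I * u : ℂ).re := by simpa using hη
  have j1 := (integrableOn_exp_mul_complex_Ioi i1 0).congr_fun e1 measurableSet_Ioi
  have j2 := ((integrableOn_exp_mul_complex_Iic i2 0).mono_set Set.Iio_subset_Iic_self).neg.congr_fun
    e2 measurableSet_Iio
  have j2' := Iff.mpr integrableOn_Iic_iff_integrableOn_Iio j2
  rw [← setIntegral_univ, ← Set.Iic_union_Ioi (a := (0 : ℝ)),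
    setIntegral_union (Set.Iic_disjoint_Ioi le_rfl) measurableSet_Ioi j2' j1,
    integral_Iic_eq_integral_Iio, ← setIntegral_congr_fun measurableSet_Iio e2,
    ← setIntegral_congr_fun measurableSet_Ioi e1, integral_neg, ← integral_Iic_eq_integral_Iio,
    integral_exp_mul_complex_Iic i2, integral_exp_mul_complex_Ioi i1]
  have n1 : (-η - Complex.I * u : ℂ) ≠ 0 := fun h => by simp [h] at i1
  have n2 : (η - Complex.I * u : ℂ) ≠ 0 := fun h => by simp [h] at i2
  have n3 : (η ^ 2 + u ^ 2 : ℂ) ≠ 0 := by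
    have : (η ^ 2 + u ^ 2 : ℝ) ≠ 0 := by positivity
    exact_mod_cast this
  have n4 : (η ^ 2 + u ^ 2 : ℂ) = -(-η - Complex.I * u) * (η - Complex.I * u) := by
    linear_combination (u ^ 2 : ℂ) * Complex.I_sq
  simp only [Complex.ofReal_zero, mul_zero, Complex.exp_zero]
  push_cast
  rw [n4]
  field_simp
  ring

lemma integrable_mul_kernel {f g : ℝ → ℂ} (hf : Integrable f) (hg : Integrable g) {F : ℝ × ℝ → ℂ}
    (hF : AEStronglyMeasurable F ((volume : Measure ℝ).prod volume)) {C : ℝ}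
    (h : ∀ z, ‖F z‖ ≤ C * (‖f z.1‖ * ‖g z.2‖ + ‖g z.1‖ * ‖f z.2‖)) :
    Integrable F ((volume : Measure ℝ).prod volume) :=
  (((hf.norm.mul_prod hg.norm).add (hg.norm.mul_prod hf.norm)).const_mul C).mono' hF
    (.of_forall h)

lemma aestronglyMeasurable_mul_conj {f : ℝ → ℂ} (hf : AEStronglyMeasurable f volume) :
    AEStronglyMeasurable (fun z : ℝ × ℝ => f z.1 * conj (f z.2))
      ((volume : Measure ℝ).prod volume) :=
  hf.comp_fst.mul (RCLike.continuous_conj.comp_aestronglyMeasurable hf.comp_snd)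

lemma abs_sin_mul_le (c u : ℝ) : |Real.sin (c * u)| ≤ |c| * |u| := by
  rw [← abs_mul]; exact Real.abs_sin_le_abs

lemma tendsto_integral_regularized {Φ : ℝ → ℂ} (h1 : Integrable Φ)
    (h2 : Integrable (fun x : ℝ => (x : ℂ) * Φ x)) (c : ℝ) :
    Filter.Tendsto (fun η : ℝ => ∫ z : ℝ × ℝ, Φ z.1 * conj (Φ z.2) *
        ((Real.sin (c * (z.1 ^ 2 - z.2 ^ 2)) * ((z.1 - z.2) / (η ^ 2 + (z.1 - z.2) ^ 2)) : ℝ) : ℂ)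
        ∂((volume : Measure ℝ).prod volume)) (nhdsWithin 0 (Set.Ioi 0))
      (nhds (∫ z : ℝ × ℝ, Φ z.1 * conj (Φ z.2) *
        ((Real.sin (c * (z.1 ^ 2 - z.2 ^ 2)) / (z.1 - z.2) : ℝ) : ℂ)
        ∂((volume : Measure ℝ).prod volume))) := by
  refine tendsto_integral_filter_of_dominated_convergence
    (fun z => |c| * (‖(z.1 : ℂ) * Φ z.1‖ * ‖Φ z.2‖ + ‖Φ z.1‖ * ‖(z.2 : ℂ) * Φ z.2‖)) ?_ ?_ ?_ ?_
  · refine .of_forall fun η => (aestronglyMeasurable_mul_conj h1.aestronglyMeasurable).mul ?_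
    exact Measurable.aestronglyMeasurable (by fun_prop)
  · refine .of_forall fun η => .of_forall fun z => ?_
    have hs := abs_sin_mul_le c (z.1 ^ 2 - z.2 ^ 2)
    have hk : |z.1 - z.2| * |(z.1 - z.2) / (η ^ 2 + (z.1 - z.2) ^ 2)| ≤ 1 := by
      rw [abs_div, abs_of_nonneg (by positivity : 0 ≤ η ^ 2 + (z.1 - z.2) ^ 2), ← mul_div_assoc,
        abs_mul_abs_self]
      exact div_le_one_of_le₀ (by nlinarith [sq_nonneg η]) (by positivity)
    have hf : |z.1 ^ 2 - z.2 ^ 2| = |z.1 + z.2| * |z.1 - z.2| := by rw [← abs_mul]; ring_nf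
    have hA := abs_add_le z.1 z.2
    have : |Real.sin (c * (z.1 ^ 2 - z.2 ^ 2)) * ((z.1 - z.2) / (η ^ 2 + (z.1 - z.2) ^ 2))| ≤
        |c| * (|z.1| + |z.2|) := by
      rw [abs_mul]
      calc _ ≤ (|c| * |z.1 ^ 2 - z.2 ^ 2|) * |(z.1 - z.2) / (η ^ 2 + (z.1 - z.2) ^ 2)| := by gcongr
        _ = |c| * |z.1 + z.2| * (|z.1 - z.2| * |(z.1 - z.2) / (η ^ 2 + (z.1 - z.2) ^ 2)|) := by
          rw [hf]; ring
        _ ≤ |c| * (|z.1| + |z.2|) * 1 := by gcongr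
        _ = _ := mul_one _
    rw [norm_mul, norm_mul, RCLike.norm_conj, Complex.norm_real, Real.norm_eq_abs, norm_mul, norm_mul,
      Complex.norm_real, Complex.norm_real, Real.norm_eq_abs, Real.norm_eq_abs]
    calc _ ≤ ‖Φ z.1‖ * ‖Φ z.2‖ * (|c| * (|z.1| + |z.2|)) := by gcongr
      _ = _ := by ring
  · exact ((h2.norm.mul_prod h1.norm).add (h1.norm.mul_prod h2.norm)).const_mul _
  · refine .of_forall fun z => ?_
    refine Filter.Tendsto.mono_left (Filter.Tendsto.const_mul _ ?_) nhdsWithin_le_nhds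
    refine (Complex.continuous_ofReal.tendsto _).comp ?_
    by_cases hz : z.1 - z.2 = 0
    · simp [hz]
    · have : Real.sin (c * (z.1 ^ 2 - z.2 ^ 2)) / (z.1 - z.2) =
          Real.sin (c * (z.1 ^ 2 - z.2 ^ 2)) * ((z.1 - z.2) / (0 ^ 2 + (z.1 - z.2) ^ 2)) := by
        field_simp; ring
      rw [this]
      refine ContinuousAt.tendsto (f := fun η : ℝ => Real.sin (c * (z.1 ^ 2 - z.2 ^ 2)) *
        ((z.1 - z.2) / (η ^ 2 + (z.1 - z.2) ^ 2))) ?_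
      refine continuousAt_const.mul (continuousAt_const.div (by fun_prop) ?_)
      positivity

lemma ae_prod_sq_ne_sq :
    ∀ᵐ z : ℝ × ℝ ∂((volume : Measure ℝ).prod volume), z.1 ^ 2 - z.2 ^ 2 ≠ 0 := by
  have hs : MeasurableSet {z : ℝ × ℝ | z.1 ^ 2 - z.2 ^ 2 ≠ 0} :=
    (measurableSet_eq_fun (f := fun z : ℝ × ℝ => z.1 ^ 2 - z.2 ^ 2) (by fun_prop)
      measurable_const).compl
  rw [Measure.ae_prod_iff_ae_ae hs]
  refine .of_forall fun x => ?_
  have : ({x, -x} : Set ℝ)ᶜ ∈ ae (volume : Measure ℝ) := by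
    rw [mem_ae_iff, compl_compl]
    exact (Set.toFinite _).measure_zero _
  filter_upwards [this] with y hy h
  refine hy ?_
  have : (y - x) * (y + x) = 0 := by linarith
  rcases mul_eq_zero.1 this with h | h
  · left; linarith
  · right; exact Set.mem_singleton_iff.2 (by linarith)

lemma integral_indicator_exp {c u : ℝ} (hc : 0 ≤ c) (hu : u ≠ 0) :
    ∫ p : ℝ, (Set.Ioc (-c) c).indicator (fun _ => (1 : ℂ)) p * Complex.exp (-Complex.I * p * u) =
      ((2 * (Real.sin (c * u) / u) : ℝ) : ℂ) := by
  have h : ∀ p : ℝ, (Set.Ioc (-c) c).indicator (fun _ => (1 : ℂ)) p *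
      Complex.exp (-Complex.I * p * u) =
      (Set.Ioc (-c) c).indicator (fun p : ℝ => Complex.exp ((-Complex.I * u) * p)) p := fun p => by
    by_cases hp : p ∈ Set.Ioc (-c) c
    · simp only [Set.indicator_of_mem hp, one_mul]; ring_nf
    · simp [Set.indicator_of_notMem hp]
  have hu' : (u : ℂ) ≠ 0 := by exact_mod_cast hu
  simp_rw [h]
  rw [integral_indicator measurableSet_Ioc, ← intervalIntegral.integral_of_le (by linarith),
    integral_exp_mul_complex (by simp [hu'])]
  push_cast
  rw [Complex.sin]
  have e1 : (-Complex.I * u * c : ℂ) = -(c * u) * Complex.I := by ring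
  have e2 : (-Complex.I * u * -c : ℂ) = (c * u) * Complex.I := by ring
  rw [e1, e2]
  field_simp
  linear_combination (Complex.exp (c * u * Complex.I) - Complex.exp (-(c * u * Complex.I))) *
    Complex.I_sq

lemma re_integral_mul_sin_div_nonneg {Ψ : ℝ → ℂ} (hΨ : Integrable Ψ) {c : ℝ} (hc : 0 ≤ c) :
    0 ≤ (∫ z : ℝ × ℝ, Ψ z.1 * conj (Ψ z.2) *
      ((Real.sin (c * (z.1 ^ 2 - z.2 ^ 2)) / (z.1 ^ 2 - z.2 ^ 2) : ℝ) : ℂ)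
      ∂((volume : Measure ℝ).prod volume)).re := by
  have hw : Integrable ((Set.Ioc (-c) c).indicator (fun _ : ℝ => (1 : ℂ))) :=
    (integrable_indicator_iff measurableSet_Ioc).2 (by simp)
  have key := integral_mul_normSq_oscillatory hΨ hw (θ := fun x => x ^ 2) (by fun_prop)
  have h2 : ∫ z : ℝ × ℝ, Ψ z.1 * conj (Ψ z.2) * (∫ p : ℝ, (Set.Ioc (-c) c).indicator
        (fun _ : ℝ => (1 : ℂ)) p * Complex.exp (-Complex.I * p * ((z.1 ^ 2 - z.2 ^ 2 : ℝ) : ℂ)))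
        ∂((volume : Measure ℝ).prod volume) =
      2 * ∫ z : ℝ × ℝ, Ψ z.1 * conj (Ψ z.2) *
        ((Real.sin (c * (z.1 ^ 2 - z.2 ^ 2)) / (z.1 ^ 2 - z.2 ^ 2) : ℝ) : ℂ)
        ∂((volume : Measure ℝ).prod volume) := by
    rw [← integral_const_mul]
    refine integral_congr_ae ?_
    filter_upwards [ae_prod_sq_ne_sq] with z hz
    rw [integral_indicator_exp hc hz]
    push_cast
    ring
  rw [h2] at key
  set J := ∫ z : ℝ × ℝ, Ψ z.1 * conj (Ψ z.2) *
        ((Real.sin (c * (z.1 ^ 2 - z.2 ^ 2)) / (z.1 ^ 2 - z.2 ^ 2) : ℝ) : ℂ)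
        ∂((volume : Measure ℝ).prod volume)
  have h3 : ∀ p : ℝ, (Set.Ioc (-c) c).indicator (fun _ => (1 : ℂ)) p *
      ((∫ q, Complex.exp (-Complex.I * p * ((q ^ 2 : ℝ) : ℂ)) * Ψ q) *
        conj (∫ q, Complex.exp (-Complex.I * p * ((q ^ 2 : ℝ) : ℂ)) * Ψ q)) =
      (((Set.Ioc (-c) c).indicator (fun _ => (1 : ℝ)) p *
        Complex.normSq (∫ q, Complex.exp (-Complex.I * p * ((q ^ 2 : ℝ) : ℂ)) * Ψ q) : ℝ) : ℂ) :=
    fun p => by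
      rw [Complex.mul_conj]
      by_cases hp : p ∈ Set.Ioc (-c) c
      · simp [Set.indicator_of_mem hp]
      · simp [Set.indicator_of_notMem hp]
  simp_rw [h3] at key
  rw [integral_complex_ofReal] at key
  have h4 : 2 * J.re = ∫ p : ℝ, (Set.Ioc (-c) c).indicator (fun _ => (1 : ℝ)) p *
        Complex.normSq (∫ q, Complex.exp (-Complex.I * p * ((q ^ 2 : ℝ) : ℂ)) * Ψ q) := by
    have := congrArg Complex.re key
    simpa using this.symm
  have h5 : 0 ≤ 2 * J.re := by
    rw [h4]
    refine integral_nonneg fun p => mul_nonneg ?_ (Complex.normSq_nonneg _)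
    exact Set.indicator_nonneg (fun _ _ => zero_le_one) _
  linarith

/-- The remainder of the kernel `sin (c (x² - y²)) / (x - y)` after removing its positive part. -/
def sinRemainder (c : ℝ) (z : ℝ × ℝ) : ℝ :=
  (√(|z.1|) - √(|z.2|)) ^ 2 * (Real.sin (c * (z.1 ^ 2 - z.2 ^ 2)) / (z.1 ^ 2 - z.2 ^ 2))

lemma abs_sinRemainder_le (c : ℝ) (z : ℝ × ℝ) :
    |sinRemainder c z| ≤ sqrtKernel |z.1| |z.2| := by
  have e1 := Real.sq_sqrt (abs_nonneg z.1)
  have e2 := Real.sq_sqrt (abs_nonneg z.2)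
  have f1 := Real.sqrt_nonneg |z.1|
  have f2 := Real.sqrt_nonneg |z.2|
  have h : z.1 ^ 2 - z.2 ^ 2 =
      (√(|z.1|) - √(|z.2|)) * ((√(|z.1|) + √(|z.2|)) * (|z.1| + |z.2|)) := by
    rw [← sq_abs z.1, ← sq_abs z.2]
    linear_combination (-(|z.1| + |z.2|)) * e1 + (|z.1| + |z.2|) * e2
  unfold sinRemainder sqrtKernel
  rw [abs_mul, abs_div, abs_pow]
  rcases eq_or_ne (√(|z.1|) - √(|z.2|)) 0 with h0 | h0
  · rw [h0]; simp
  calc _ ≤ |√(|z.1|) - √(|z.2|)| ^ 2 * (1 / |z.1 ^ 2 - z.2 ^ 2|) := by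
        gcongr; exact Real.abs_sin_le_one _
    _ = _ := by
        rw [h, abs_mul, abs_of_nonneg (by positivity : 0 ≤ (√(|z.1|) + √(|z.2|)) * (|z.1| + |z.2|))]
        have := abs_ne_zero.2 h0
        field_simp

lemma abs_sin_div_le (c u : ℝ) : |Real.sin (c * u) / u| ≤ |c| := by
  rw [abs_div]
  rcases eq_or_ne u 0 with h | h
  · simp [h]
  · rw [div_le_iff₀ (abs_pos.2 h)]; exact abs_sin_mul_le c u

/-- On a half line, the kernel `sin (c (x² - y²)) / (x - y)` is bounded below. -/
lemma neg_le_re_integral_sin_div {Φ : ℝ → ℂ} (h1 : Integrable Φ)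
    (h2 : Integrable (fun x : ℝ => (x : ℂ) * Φ x)) (h3 : Integrable (fun x => ‖Φ x‖ ^ 2))
    {σ : ℝ} (hσ : σ ^ 2 = 1) (hσΦ : ∀ x, Φ x ≠ 0 → 0 ≤ σ * x) {c : ℝ} (hc : 0 ≤ c) :
    -(4 * Real.log 2 * ∫ x, ‖Φ x‖ ^ 2) ≤ σ * (∫ z : ℝ × ℝ, Φ z.1 * conj (Φ z.2) *
      ((Real.sin (c * (z.1 ^ 2 - z.2 ^ 2)) / (z.1 - z.2) : ℝ) : ℂ)
      ∂((volume : Measure ℝ).prod volume)).re := by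
  set Ψ : ℝ → ℂ := fun x => ((√|x| : ℝ) : ℂ) * Φ x with hΨdef
  have hsq : ∀ x : ℝ, √|x| ≤ 1 + |x| := fun x => by
    rw [Real.sqrt_le_left (by positivity)]; nlinarith [abs_nonneg x]
  have hΨ : Integrable Ψ := by
    refine (h1.norm.add h2.norm).mono' ?_ (.of_forall fun x => ?_)
    · exact (Measurable.aestronglyMeasurable (by fun_prop)).mul h1.aestronglyMeasurable
    · simp only [hΨdef, Pi.add_apply, norm_mul, Complex.norm_real, Real.norm_eq_abs,
        abs_of_nonneg (Real.sqrt_nonneg |x|)]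
      nlinarith [hsq x, norm_nonneg (Φ x)]
  have iP : Integrable (fun z : ℝ × ℝ => Ψ z.1 * conj (Ψ z.2) *
      ((Real.sin (c * (z.1 ^ 2 - z.2 ^ 2)) / (z.1 ^ 2 - z.2 ^ 2) : ℝ) : ℂ))
      ((volume : Measure ℝ).prod volume) := by
    refine integrable_mul_kernel hΨ hΨ (C := |c|)
      ((aestronglyMeasurable_mul_conj hΨ.aestronglyMeasurable).mul
        (Measurable.aestronglyMeasurable (by fun_prop))) fun z => ?_
    rw [norm_mul, norm_mul, RCLike.norm_conj, Complex.norm_real, Real.norm_eq_abs]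
    have := abs_sin_div_le c (z.1 ^ 2 - z.2 ^ 2)
    have h0 : 0 ≤ ‖Ψ z.1‖ * ‖Ψ z.2‖ := by positivity
    nlinarith [mul_le_mul_of_nonneg_left this h0, abs_nonneg c,
      mul_nonneg h0 (abs_nonneg c)]
  have iR : Integrable (fun z : ℝ × ℝ => Φ z.1 * conj (Φ z.2) * ((sinRemainder c z : ℝ) : ℂ))
      ((volume : Measure ℝ).prod volume) := by
    refine integrable_mul_kernel h2 h1 (C := |c|)
      ((aestronglyMeasurable_mul_conj h1.aestronglyMeasurable).mul
        (Measurable.aestronglyMeasurable (by unfold sinRemainder; fun_prop))) fun z => ?_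
    rw [norm_mul, norm_mul, RCLike.norm_conj, Complex.norm_real, Real.norm_eq_abs, sinRemainder,
      abs_mul, abs_pow, sq_abs, norm_mul, norm_mul, Complex.norm_real, Complex.norm_real,
      Real.norm_eq_abs, Real.norm_eq_abs]
    have := abs_sin_div_le c (z.1 ^ 2 - z.2 ^ 2)
    have hb : (√(|z.1|) - √(|z.2|)) ^ 2 ≤ |z.1| + |z.2| := by
      nlinarith [Real.sq_sqrt (abs_nonneg z.1), Real.sq_sqrt (abs_nonneg z.2),
        mul_nonneg (Real.sqrt_nonneg |z.1|) (Real.sqrt_nonneg |z.2|)]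
    calc _ ≤ ‖Φ z.1‖ * ‖Φ z.2‖ * ((|z.1| + |z.2|) * |c|) := by gcongr
      _ = _ := by ring
  have hsplit : ∀ z : ℝ × ℝ, (σ : ℂ) * (Φ z.1 * conj (Φ z.2) *
      ((Real.sin (c * (z.1 ^ 2 - z.2 ^ 2)) / (z.1 - z.2) : ℝ) : ℂ)) =
      2 * (Ψ z.1 * conj (Ψ z.2) *
      ((Real.sin (c * (z.1 ^ 2 - z.2 ^ 2)) / (z.1 ^ 2 - z.2 ^ 2) : ℝ) : ℂ)) +
      Φ z.1 * conj (Φ z.2) * ((sinRemainder c z : ℝ) : ℂ) := fun z => by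
    by_cases hz1 : Φ z.1 = 0
    · simp [hΨdef, hz1]
    by_cases hz2 : Φ z.2 = 0
    · simp [hΨdef, hz2]
    have hab : ∀ x, 0 ≤ σ * x → σ * x = |x| := fun x hx => by
      have : |σ| = 1 := by
        rw [← sq_eq_sq₀ (abs_nonneg _) zero_le_one, sq_abs, hσ, one_pow]
      rw [← abs_of_nonneg hx, abs_mul, this, one_mul]
    have a1 := hab _ (hσΦ _ hz1)
    have a2 := hab _ (hσΦ _ hz2)
    have hreal : σ * (Real.sin (c * (z.1 ^ 2 - z.2 ^ 2)) / (z.1 - z.2)) =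
        (2 * √(|z.1|) * √(|z.2|) + (√(|z.1|) - √(|z.2|)) ^ 2) *
          (Real.sin (c * (z.1 ^ 2 - z.2 ^ 2)) / (z.1 ^ 2 - z.2 ^ 2)) := by
      have e : 2 * √(|z.1|) * √(|z.2|) + (√(|z.1|) - √(|z.2|)) ^ 2 = σ * (z.1 + z.2) := by
        have e1 := Real.sq_sqrt (abs_nonneg z.1)
        have e2 := Real.sq_sqrt (abs_nonneg z.2)
        linear_combination e1 + e2 - a1 - a2
      rw [e]
      by_cases hs : z.1 + z.2 = 0
      · have : z.1 ^ 2 - z.2 ^ 2 = 0 := by linear_combination (z.1 - z.2) * hs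
        simp [this]
      by_cases hd : z.1 - z.2 = 0
      · have : z.1 ^ 2 - z.2 ^ 2 = 0 := by linear_combination (z.1 + z.2) * hd
        simp [this]
      have : z.1 ^ 2 - z.2 ^ 2 = (z.1 + z.2) * (z.1 - z.2) := by ring
      generalize Real.sin (c * (z.1 ^ 2 - z.2 ^ 2)) = S
      rw [this]
      field_simp
    have hc' := congrArg (fun r : ℝ => (r : ℂ)) hreal
    simp only [hΨdef, sinRemainder, map_mul, Complex.conj_ofReal]
    push_cast at hc' ⊢
    linear_combination (Φ z.1 * conj (Φ z.2)) * hc'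
  have hre : σ * (∫ z : ℝ × ℝ, Φ z.1 * conj (Φ z.2) *
      ((Real.sin (c * (z.1 ^ 2 - z.2 ^ 2)) / (z.1 - z.2) : ℝ) : ℂ)
      ∂((volume : Measure ℝ).prod volume)).re =
      2 * (∫ z : ℝ × ℝ, Ψ z.1 * conj (Ψ z.2) *
      ((Real.sin (c * (z.1 ^ 2 - z.2 ^ 2)) / (z.1 ^ 2 - z.2 ^ 2) : ℝ) : ℂ)
      ∂((volume : Measure ℝ).prod volume)).re +
      (∫ z : ℝ × ℝ, Φ z.1 * conj (Φ z.2) * ((sinRemainder c z : ℝ) : ℂ)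
      ∂((volume : Measure ℝ).prod volume)).re := by
    rw [← Complex.re_ofReal_mul, ← integral_const_mul]
    simp_rw [hsplit]
    rw [integral_add (iP.const_mul 2) iR, integral_const_mul, Complex.add_re]
    simp
  have hP := re_integral_mul_sin_div_nonneg hΨ hc
  have hR := norm_integral_kernel_le h3 (m := fun z => ((sinRemainder c z : ℝ) : ℂ)) (fun z => by
    rw [Complex.norm_real, Real.norm_eq_abs]; exact abs_sinRemainder_le c z)
  have hR' := (abs_le.1 ((Complex.abs_re_le_norm _).trans hR)).1
  rw [hre]
  linarith

lemma norm_chi (t q : ℝ) : ‖chi t q‖ = 1 := by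
  have : -(Complex.I / 2) * ((Real.cos t / Real.sin t : ℝ) : ℂ) * (q : ℂ) ^ 2 =
      ((-(Real.cos t / Real.sin t / 2) * q ^ 2 : ℝ) : ℂ) * Complex.I := by push_cast; ring
  rw [chi, this, Complex.norm_exp_ofReal_mul_I]

lemma inv_chi (t q : ℝ) :
    (chi t q)⁻¹ = Complex.exp (((Real.cos t / Real.sin t / 2 * q ^ 2 : ℝ) : ℂ) * Complex.I) := by
  rw [chi, ← Complex.exp_neg]
  congr 1
  push_cast
  ring

lemma IsMulOp.norm_apply_le {g : ℝ → ℂ} {T : L2 →L[ℂ] L2} (h : IsMulOp g T)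
    (hg : ∀ q, ‖g q‖ ≤ 1) (u : L2) : ‖T u‖ ≤ ‖u‖ := by
  refine Lp.norm_le_norm_of_ae_le ?_
  filter_upwards [h u] with q hq
  rw [hq, norm_mul]
  exact mul_le_of_le_one_left (norm_nonneg _) (hg q)

lemma IsMulOp.inner_apply {g k : ℝ → ℂ} {T U : L2 →L[ℂ] L2} (hT : IsMulOp g T)
    (hU : IsMulOp k U) (hgk : ∀ q, conj (g q) = k q) (u v : L2) :
    ⟪T u, v⟫_ℂ = ⟪u, U v⟫_ℂ := by
  rw [L2.inner_def, L2.inner_def]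
  refine integral_congr_ae ?_
  filter_upwards [hT u, hU v] with q h1 h2
  simp only [h1, h2, RCLike.inner_apply, map_mul, hgk]
  ring

lemma conj_chi (t q : ℝ) : conj (chi t q) = (chi t q)⁻¹ :=
  (Complex.inv_eq_conj (norm_chi t q)).symm

lemma conj_inv_chi (t q : ℝ) : conj (chi t q)⁻¹ = chi t q := by
  rw [← conj_chi, Complex.conj_conj]

lemma norm_ofReal_sign_le (p : ℝ) : ‖((Real.sign p : ℝ) : ℂ)‖ ≤ 1 := by
  obtain h | h | h := Real.sign_apply_eq p <;> simp [h]

lemma IsSgnP.norm_apply_le {P : L2 →L[ℂ] L2} (h : IsSgnP P) (u : L2) : ‖P u‖ ≤ ‖u‖ := by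
  obtain ⟨F, -, hF⟩ := h
  rw [← F.norm_map (P u), ← F.norm_map u]
  refine Lp.norm_le_norm_of_ae_le ?_
  filter_upwards [hF u] with p hp
  rw [hp, norm_mul]
  exact mul_le_of_le_one_left (norm_nonneg _) (norm_ofReal_sign_le p)

lemma IsSgnP.inner_apply {P : L2 →L[ℂ] L2} (h : IsSgnP P) (u v : L2) :
    ⟪P u, v⟫_ℂ = ⟪u, P v⟫_ℂ := by
  obtain ⟨F, -, hF⟩ := h
  rw [← F.inner_map_map, ← F.inner_map_map u, L2.inner_def, L2.inner_def]
  refine integral_congr_ae ?_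
  filter_upwards [hF u, hF v] with p h1 h2
  simp only [h1, h2, RCLike.inner_apply, map_mul, Complex.conj_ofReal]
  ring

lemma IsSgnQ.norm_apply_le {t : ℝ} {T : L2 →L[ℂ] L2} (h : IsSgnQ t T) (u : L2) :
    ‖T u‖ ≤ ‖u‖ := by
  unfold IsSgnQ at h
  split_ifs at h
  · exact h.norm_apply_le norm_ofReal_sign_le u
  · obtain ⟨P, Mc, Mci, hP, hMc, hMci, rfl⟩ := h
    have h1 : ‖Mc (P (Mci u))‖ ≤ ‖u‖ :=
      (hMc.norm_apply_le (fun q => (norm_chi t q).le) _).trans <| (hP.norm_apply_le _).trans <|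
        hMci.norm_apply_le (fun q => by rw [norm_inv, norm_chi, inv_one]) _
    calc ‖((Real.sign (Real.sin t) : ℝ) : ℂ) • Mc (P (Mci u))‖
        = ‖((Real.sign (Real.sin t) : ℝ) : ℂ)‖ * ‖Mc (P (Mci u))‖ := norm_smul _ _
      _ ≤ 1 * ‖u‖ := by gcongr; exact norm_ofReal_sign_le _
      _ = ‖u‖ := one_mul _

lemma IsSgnQ.inner_apply {t : ℝ} {T : L2 →L[ℂ] L2} (h : IsSgnQ t T) (u v : L2) :
    ⟪T u, v⟫_ℂ = ⟪u, T v⟫_ℂ := by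
  unfold IsSgnQ at h
  split_ifs at h
  · exact h.inner_apply h (fun q => Complex.conj_ofReal _) u v
  · obtain ⟨P, Mc, Mci, hP, hMc, hMci, rfl⟩ := h
    change ⟪((Real.sign (Real.sin t) : ℝ) : ℂ) • Mc (P (Mci u)), v⟫_ℂ =
      ⟪u, ((Real.sign (Real.sin t) : ℝ) : ℂ) • Mc (P (Mci v))⟫_ℂ
    rw [inner_smul_left, inner_smul_right, Complex.conj_ofReal,
      hMc.inner_apply hMci (conj_chi t), hP.inner_apply, hMci.inner_apply hMc (conj_inv_chi t)]

/-- The quadratic form of `sgn P` as a limit of absolutely convergent double integrals. -/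
lemma IsSgnP.tendsto_inner {P : L2 →L[ℂ] L2} (h : IsSgnP P) {φ : L2} {f : ℝ → ℂ}
    (hφ : φ =ᵐ[volume] f) (hf : Integrable f) :
    Filter.Tendsto (fun η : ℝ => ((2 * π : ℝ) : ℂ)⁻¹ * ∫ z : ℝ × ℝ, f z.1 * conj (f z.2) *
        (-2 * Complex.I * (((z.1 - z.2) / (η ^ 2 + (z.1 - z.2) ^ 2) : ℝ) : ℂ))
        ∂((volume : Measure ℝ).prod volume)) (nhdsWithin 0 (Set.Ioi 0))
      (nhds ⟪φ, P φ⟫_ℂ) := by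
  obtain ⟨F, hF, hFP⟩ := h
  set H : ℝ → ℂ := fun p => ∫ q : ℝ, Complex.exp (-Complex.I * p * q) * f q with hH
  have hpi : (0 : ℝ) < 2 * π := by positivity
  have hFφ : F φ =ᵐ[volume] fun p => (((2 * π) ^ (-(1:ℝ)/2) : ℝ) : ℂ) * H p := by
    filter_upwards [hF φ (hf.congr hφ.symm)] with p hp
    rw [hp, hH]
    congr 1
    refine integral_congr_ae ?_
    filter_upwards [hφ] with q hq
    rw [hq]
  have hk : (((2 * π) ^ (-(1:ℝ)/2) : ℝ) : ℂ) * (((2 * π) ^ (-(1:ℝ)/2) : ℝ) : ℂ) =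
      ((2 * π : ℝ) : ℂ)⁻¹ := by
    rw [← Complex.ofReal_mul, ← Real.rpow_add hpi, ← Complex.ofReal_inv, ← Real.rpow_neg_one]
    norm_num
  have hnorm : (fun p => ⟪F φ p, F φ p⟫_ℂ) =ᵐ[volume]
      fun p => ((2 * π : ℝ) : ℂ)⁻¹ * (H p * conj (H p)) := by
    filter_upwards [hFφ] with p hp
    rw [hp, ← hk]
    simp only [RCLike.inner_apply, map_mul, Complex.conj_ofReal]
    ring
  have hHint : Integrable (fun p => ((2 * π : ℝ) : ℂ)⁻¹ * (H p * conj (H p))) :=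
    (L2.integrable_inner (F φ) (F φ)).congr hnorm
  have hinner : ⟪φ, P φ⟫_ℂ =
      ∫ p : ℝ, ((Real.sign p : ℝ) : ℂ) * (((2 * π : ℝ) : ℂ)⁻¹ * (H p * conj (H p))) := by
    rw [← F.inner_map_map, L2.inner_def]
    refine integral_congr_ae ?_
    filter_upwards [hFP φ, hnorm] with p h1 h2
    rw [← h2, h1]
    simp only [RCLike.inner_apply]
    ring
  have hlim : Filter.Tendsto (fun η : ℝ => ∫ p : ℝ,
      ((Real.sign p * Real.exp (-η * |p|) : ℝ) : ℂ) *
        (((2 * π : ℝ) : ℂ)⁻¹ * (H p * conj (H p)))) (nhdsWithin 0 (Set.Ioi 0))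
      (nhds ⟪φ, P φ⟫_ℂ) := by
    rw [hinner]
    refine tendsto_integral_filter_of_dominated_convergence _ ?_ ?_ hHint.norm ?_
    · filter_upwards [self_mem_nhdsWithin] with η hη
      exact (integrable_sign_mul_exp hη).aestronglyMeasurable.mul hHint.aestronglyMeasurable
    · filter_upwards [self_mem_nhdsWithin] with η hη
      refine .of_forall fun p => ?_
      rw [norm_mul, Complex.ofReal_mul, norm_mul]
      refine mul_le_of_le_one_left (norm_nonneg _) ?_
      refine mul_le_one₀ (norm_ofReal_sign_le p) (norm_nonneg _) ?_
      rw [Complex.norm_real, Real.norm_of_nonneg (Real.exp_pos _).le, Real.exp_le_one_iff]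
      have := mul_nonneg (le_of_lt hη) (abs_nonneg p)
      linarith
    · refine .of_forall fun p => ?_
      refine Filter.Tendsto.mono_left (Filter.Tendsto.mul_const _ ?_) nhdsWithin_le_nhds
      refine (Complex.continuous_ofReal.tendsto _).comp ?_
      have : Continuous fun η : ℝ => Real.sign p * Real.exp (-η * |p|) := by fun_prop
      simpa using this.tendsto 0
  refine hlim.congr' ?_
  filter_upwards [self_mem_nhdsWithin] with η (hη : 0 < η)
  have key := integral_mul_normSq_oscillatory hf (integrable_sign_mul_exp hη)
    (θ := fun x => x) continuous_id
  simp_rw [integral_sign_mul_exp hη] at key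
  have e1 : ∀ p : ℝ, ((Real.sign p * Real.exp (-η * |p|) : ℝ) : ℂ) *
      (((2 * π : ℝ) : ℂ)⁻¹ * (H p * conj (H p))) =
      ((2 * π : ℝ) : ℂ)⁻¹ * (((Real.sign p * Real.exp (-η * |p|) : ℝ) : ℂ) *
        (H p * conj (H p))) := fun p => by ring
  simp_rw [e1]
  rw [integral_const_mul, key]
  congr 2 with z
  push_cast
  ring

/-- The quadratic form of `sgn Q(t)` as a limit of absolutely convergent double integrals. -/
lemma IsSgnQ.tendsto_inner {t : ℝ} (ht : t ≠ 0) {T : L2 →L[ℂ] L2} (h : IsSgnQ t T) {φ : L2}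
    {f : ℝ → ℂ} (hφ : φ =ᵐ[volume] fun q => chi t q * f q) (hf : Integrable f) :
    Filter.Tendsto (fun η : ℝ => ((Real.sign (Real.sin t) : ℝ) : ℂ) *
        (((2 * π : ℝ) : ℂ)⁻¹ * ∫ z : ℝ × ℝ, f z.1 * conj (f z.2) *
        (-2 * Complex.I * (((z.1 - z.2) / (η ^ 2 + (z.1 - z.2) ^ 2) : ℝ) : ℂ))
        ∂((volume : Measure ℝ).prod volume))) (nhdsWithin 0 (Set.Ioi 0))
      (nhds ⟪φ, T φ⟫_ℂ) := by
  unfold IsSgnQ at h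
  rw [if_neg ht] at h
  obtain ⟨P, Mc, Mci, hP, hMc, hMci, rfl⟩ := h
  have e : ⟪φ, (((Real.sign (Real.sin t) : ℝ) : ℂ) • (Mc ∘L P ∘L Mci)) φ⟫_ℂ =
      ((Real.sign (Real.sin t) : ℝ) : ℂ) * ⟪Mci φ, P (Mci φ)⟫_ℂ := by
    rw [hMci.inner_apply hMc (conj_inv_chi t), ← inner_smul_right]
    rfl
  rw [e]
  refine Filter.Tendsto.const_mul _ (hP.tendsto_inner ?_ hf)
  filter_upwards [hMci φ, hφ] with q h1 h2
  have : chi t q ≠ 0 := by rw [← norm_ne_zero_iff, norm_chi]; exact one_ne_zero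
  rw [h1, h2, inv_mul_cancel_left₀ this]

lemma integrable_kernel_div {f : ℝ → ℂ} (hf : Integrable f) {η : ℝ} (hη : 0 < η) :
    Integrable (fun z : ℝ × ℝ => f z.1 * conj (f z.2) *
        (-2 * Complex.I * (((z.1 - z.2) / (η ^ 2 + (z.1 - z.2) ^ 2) : ℝ) : ℂ)))
      ((volume : Measure ℝ).prod volume) := by
  refine integrable_mul_kernel hf hf (C := 1 / η)
    ((aestronglyMeasurable_mul_conj hf.aestronglyMeasurable).mul
      (Measurable.aestronglyMeasurable (by fun_prop))) fun z => ?_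
  have h : |(z.1 - z.2) / (η ^ 2 + (z.1 - z.2) ^ 2)| ≤ 1 / η := by
    rw [abs_div, abs_of_pos (by positivity : 0 < η ^ 2 + (z.1 - z.2) ^ 2),
      div_le_div_iff₀ (by positivity) hη, ← sq_abs (z.1 - z.2)]
    nlinarith [sq_nonneg (η - |z.1 - z.2|), mul_nonneg hη.le (abs_nonneg (z.1 - z.2))]
  rw [norm_mul, norm_mul, norm_mul, norm_mul, RCLike.norm_conj, Complex.norm_real,
    Real.norm_eq_abs, Complex.norm_I, norm_neg, RCLike.norm_ofNat]
  calc _ ≤ ‖f z.1‖ * ‖f z.2‖ * (2 * 1 * (1 / η)) := by gcongr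
    _ = _ := by ring

lemma norm_sq_eq_integral {φ : L2} {f : ℝ → ℂ} (hφ : φ =ᵐ[volume] f) :
    Integrable (fun x => ‖f x‖ ^ 2) ∧ ∫ x, ‖f x‖ ^ 2 = ‖φ‖ ^ 2 := by
  have h1 := L2.integrable_inner (𝕜 := ℂ) φ φ
  have h2 : (fun x => (⟪φ x, φ x⟫_ℂ).re) =ᵐ[volume] fun x => ‖f x‖ ^ 2 := by
    filter_upwards [hφ] with x hx
    rw [hx]
    exact inner_self_eq_norm_sq (𝕜 := ℂ) (f x)
  refine ⟨h1.re.congr h2, ?_⟩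
  rw [← integral_congr_ae h2, ← inner_self_eq_norm_sq (𝕜 := ℂ) φ, L2.inner_def]
  exact integral_re h1

lemma integrable_exp_mul {h : ℝ → ℂ} (hh : Integrable h) (γ : ℝ) :
    Integrable (fun x => Complex.exp (((γ * x ^ 2 : ℝ) : ℂ) * Complex.I) * h x) := by
  refine hh.bdd_mul (c := 1) (Continuous.aestronglyMeasurable (by fun_prop))
    (.of_forall fun x => ?_)
  rw [Complex.norm_exp_ofReal_mul_I]

/-- For states on a half line, `sgn Q(s) + sgn Q(t)` is bounded on one side. -/
lemma re_inner_sgnQ_add_le {s t : ℝ} (hs : s ≠ 0) (ht : t ≠ 0) (hsin : 0 < Real.sin s)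
    (htin : Real.sin t < 0) (hst : 0 < Real.sin (t - s)) {A B : L2 →L[ℂ] L2} (hA : IsSgnQ s A)
    (hB : IsSgnQ t B) {φ : L2} {h : ℝ → ℂ} (hφ : φ =ᵐ[volume] h) (h1 : Integrable h)
    (h2 : Integrable (fun x : ℝ => (x : ℂ) * h x)) {σ : ℝ} (hσ : σ ^ 2 = 1)
    (hσh : ∀ x, h x ≠ 0 → 0 ≤ σ * x) :
    σ * (⟪φ, (A + B) φ⟫_ℂ).re ≤ 8 * Real.log 2 / π * ‖φ‖ ^ 2 := by
  set a : ℝ := Real.cos s / Real.sin s / 2 with ha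
  set b : ℝ := Real.cos t / Real.sin t / 2 with hb
  set c : ℝ := (b - a) / 2 with hc
  have hab : 0 ≤ c := by
    have : b - a = Real.sin (t - s) / (Real.sin s * (-Real.sin t)) / 2 := by
      have := hsin.ne'
      have := htin.ne
      rw [ha, hb, Real.sin_sub]
      field_simp
      ring
    rw [hc, this]
    have : 0 < -Real.sin t := by linarith
    positivity
  set E : ℝ → ℝ → ℂ := fun γ x => Complex.exp (((γ * x ^ 2 : ℝ) : ℂ) * Complex.I) with hE
  set Φ : ℝ → ℂ := fun x => E ((a + b) / 2) x * h x with hΦ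
  have hEnorm : ∀ γ x, ‖E γ x‖ = 1 := fun γ x => Complex.norm_exp_ofReal_mul_I _
  have hEconj : ∀ γ x, conj (E γ x) = Complex.exp (-((γ * x ^ 2 : ℝ) : ℂ) * Complex.I) :=
    fun γ x => by
      rw [hE, ← Complex.exp_conj]
      simp
  have hchi : ∀ (r : ℝ), φ =ᵐ[volume]
      fun q => chi r q * (E (Real.cos r / Real.sin r / 2) q * h q) := fun r => by
    filter_upwards [hφ] with q hq
    have hne : chi r q ≠ 0 := by rw [← norm_ne_zero_iff, norm_chi]; exact one_ne_zero
    have hE' : E (Real.cos r / Real.sin r / 2) q = (chi r q)⁻¹ := (inv_chi r q).symm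
    rw [hE', mul_inv_cancel_left₀ hne, hq]
  have lA := hA.tendsto_inner hs (hchi s) (integrable_exp_mul h1 _)
  have lB := hB.tendsto_inner ht (hchi t) (integrable_exp_mul h1 _)
  rw [Real.sign_of_pos hsin] at lA
  rw [Real.sign_of_neg htin] at lB
  have hΦ1 : Integrable Φ := integrable_exp_mul h1 _
  have hΦ2 : Integrable (fun x : ℝ => (x : ℂ) * Φ x) := by
    refine (integrable_exp_mul h2 ((a + b) / 2)).congr (.of_forall fun x => ?_)
    simp only [hΦ, hE]
    ring
  have hΦn : ∀ x, ‖Φ x‖ = ‖h x‖ := fun x => by rw [hΦ, norm_mul, hEnorm, one_mul]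
  have hpt : ∀ z : ℝ × ℝ, E a z.1 * h z.1 * conj (E a z.2 * h z.2) -
      E b z.1 * h z.1 * conj (E b z.2 * h z.2) =
      -2 * Complex.I * (Φ z.1 * conj (Φ z.2) *
        ((Real.sin (c * (z.1 ^ 2 - z.2 ^ 2)) : ℝ) : ℂ)) := fun z => by
    have e1 : E a z.1 * conj (E a z.2) = E ((a + b) / 2) z.1 * conj (E ((a + b) / 2) z.2) *
        Complex.exp (-((c * (z.1 ^ 2 - z.2 ^ 2) : ℝ) : ℂ) * Complex.I) := by
      rw [hEconj, hEconj, hE]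
      simp only [← Complex.exp_add]
      congr 1
      rw [hc]
      push_cast
      ring
    have e2 : E b z.1 * conj (E b z.2) = E ((a + b) / 2) z.1 * conj (E ((a + b) / 2) z.2) *
        Complex.exp (((c * (z.1 ^ 2 - z.2 ^ 2) : ℝ) : ℂ) * Complex.I) := by
      rw [hEconj, hEconj, hE]
      simp only [← Complex.exp_add]
      congr 1
      rw [hc]
      push_cast
      ring
    rw [Complex.ofReal_sin, Complex.sin]
    simp only [hΦ, map_mul]
    linear_combination (h z.1 * conj (h z.2)) * e1 - (h z.1 * conj (h z.2)) * e2 +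
      (h z.1 * conj (h z.2) * (E ((a + b) / 2) z.1 * conj (E ((a + b) / 2) z.2)) *
        (Complex.exp (-((c * (z.1 ^ 2 - z.2 ^ 2) : ℝ) : ℂ) * Complex.I) -
          Complex.exp (((c * (z.1 ^ 2 - z.2 ^ 2) : ℝ) : ℂ) * Complex.I))) * Complex.I_sq
  have lsum := lA.add lB
  have lC := (tendsto_integral_regularized hΦ1 hΦ2 c).const_mul (-((2 / π : ℝ) : ℂ))
  have heq : ⟪φ, (A + B) φ⟫_ℂ = -((2 / π : ℝ) : ℂ) * ∫ z : ℝ × ℝ, Φ z.1 * conj (Φ z.2) *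
        ((Real.sin (c * (z.1 ^ 2 - z.2 ^ 2)) / (z.1 - z.2) : ℝ) : ℂ)
        ∂((volume : Measure ℝ).prod volume) := by
    rw [_root_.add_apply, inner_add_right]
    refine tendsto_nhds_unique lsum (lC.congr' ?_)
    filter_upwards [self_mem_nhdsWithin] with η (hη : 0 < η)
    have i1 := integrable_kernel_div (integrable_exp_mul h1 a) hη
    have i2 := integrable_kernel_div (integrable_exp_mul h1 b) hη
    have hsub := integral_sub i1 i2
    have : (((2 / π : ℝ) : ℂ)) = 4 * ((2 * π : ℝ) : ℂ)⁻¹ := by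
      push_cast
      have : (π : ℂ) ≠ 0 := by exact_mod_cast Real.pi_ne_zero
      field_simp
      norm_num
    have hY : ∫ z : ℝ × ℝ, (E a z.1 * h z.1 * conj (E a z.2 * h z.2) *
        (-2 * Complex.I * (((z.1 - z.2) / (η ^ 2 + (z.1 - z.2) ^ 2) : ℝ) : ℂ)) -
        E b z.1 * h z.1 * conj (E b z.2 * h z.2) *
        (-2 * Complex.I * (((z.1 - z.2) / (η ^ 2 + (z.1 - z.2) ^ 2) : ℝ) : ℂ)))
        ∂((volume : Measure ℝ).prod volume) =
        -4 * ∫ z : ℝ × ℝ, Φ z.1 * conj (Φ z.2) * ((Real.sin (c * (z.1 ^ 2 - z.2 ^ 2)) *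
        ((z.1 - z.2) / (η ^ 2 + (z.1 - z.2) ^ 2)) : ℝ) : ℂ)
        ∂((volume : Measure ℝ).prod volume) := by
      rw [← integral_const_mul]
      congr 1 with z
      rw [← sub_mul, hpt]
      push_cast
      ring_nf
      simp only [Complex.I_sq]
      ring
    rw [this, Complex.ofReal_one, one_mul, Complex.ofReal_neg, Complex.ofReal_one, neg_one_mul,
      ← sub_eq_add_neg, ← mul_sub, ← hsub]
    refine Eq.trans ?_ (congrArg _ hY.symm)
    ring
  obtain ⟨n1, n2⟩ := norm_sq_eq_integral hφ
  have low := neg_le_re_integral_sin_div hΦ1 hΦ2 (by simpa only [hΦn] using n1) hσ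
    (fun x hx => hσh x (fun h0 => hx (by simp [hΦ, h0]))) hab
  simp only [hΦn, n2] at low
  rw [heq, ← Complex.ofReal_neg, Complex.re_ofReal_mul]
  have hp : 0 < 2 / π := by positivity
  have := mul_le_mul_of_nonneg_left low hp.le
  have e3 : 8 * Real.log 2 / π * ‖φ‖ ^ 2 = 2 / π * (4 * Real.log 2 * ‖φ‖ ^ 2) := by ring
  rw [e3]
  linarith

/-- The half-line estimate for the two halves of a Schwartz function. -/
lemma re_inner_half_le {s t : ℝ} (hs : s ≠ 0) (ht : t ≠ 0) (hsin : 0 < Real.sin s)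
    (htin : Real.sin t < 0) (hst : 0 < Real.sin (t - s)) {A0 A B : L2 →L[ℂ] L2}
    (hA0 : IsSgnQ 0 A0) (hA : IsSgnQ s A) (hB : IsSgnQ t B) (f : SchwartzMap ℝ ℂ) {σ : ℝ}
    (hσ : σ ^ 2 = 1) :
    σ * (⟪f.toLp 2 volume + (σ : ℂ) • A0 (f.toLp 2 volume),
        (A + B) (f.toLp 2 volume + (σ : ℂ) • A0 (f.toLp 2 volume))⟫_ℂ).re ≤
      8 * Real.log 2 / π * ‖f.toLp 2 volume + (σ : ℂ) • A0 (f.toLp 2 volume)‖ ^ 2 := by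
  rw [IsSgnQ, if_pos rfl] at hA0
  have hbd : ∀ x : ℝ, ‖((1 + σ * Real.sign x : ℝ) : ℂ)‖ ≤ 2 := fun x => by
    have hσ' : |σ| = 1 := by
      rw [← sq_eq_sq₀ (abs_nonneg _) zero_le_one, sq_abs, hσ, one_pow]
    have h1 := norm_ofReal_sign_le x
    rw [Complex.norm_real, Real.norm_eq_abs] at h1 ⊢
    calc |1 + σ * Real.sign x| ≤ |(1 : ℝ)| + |σ * Real.sign x| := abs_add_le _ _
      _ ≤ 2 := by rw [abs_mul, hσ', abs_one]; linarith
  have hmeas : AEStronglyMeasurable (fun x : ℝ => ((1 + σ * Real.sign x : ℝ) : ℂ)) volume :=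
    (Complex.measurable_ofReal.comp
      (measurable_const.add (measurable_const.mul measurable_sign))).aestronglyMeasurable
  have hx : Integrable (fun x : ℝ => (x : ℂ) * f x) := by
    refine (integrable_norm_iff (by fun_prop)).1 ?_
    refine (f.integrable_pow_mul volume 1).congr (.of_forall fun x => ?_)
    simp
  refine re_inner_sgnQ_add_le hs ht hsin htin hst hA hB
    (h := fun x => ((1 + σ * Real.sign x : ℝ) : ℂ) * f x) ?_
    (f.integrable.bdd_mul (c := 2) hmeas (.of_forall hbd)) ?_ hσ ?_
  · filter_upwards [Lp.coeFn_add (f.toLp 2 volume) ((σ : ℂ) • A0 (f.toLp 2 volume)),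
      Lp.coeFn_smul (σ : ℂ) (A0 (f.toLp 2 volume)), hA0 (f.toLp 2 volume),
      f.coeFn_toLp 2 volume] with x h1 h2 h3 h4
    rw [h1, Pi.add_apply, h2, Pi.smul_apply, h3, h4, smul_eq_mul]
    push_cast
    ring
  · refine (hx.bdd_mul (c := 2) hmeas (.of_forall hbd)).congr (.of_forall fun x => ?_)
    ring
  · intro x hne
    by_contra! hlt
    refine hne ?_
    have h : 1 + σ * Real.sign x = 0 := by
      have : σ = 1 ∨ σ = -1 := mul_self_eq_one_iff.1 (by rw [← sq, hσ])
      obtain rfl | rfl := this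
      · rw [Real.sign_of_neg (by linarith)]; norm_num
      · rw [Real.sign_of_pos (by linarith)]; norm_num
    rw [h, Complex.ofReal_zero, zero_mul]

/-- Polarisation of the half-line estimates. -/
lemma re_inner_sgn_sgnQ_add_le {s t : ℝ} (hs : s ≠ 0) (ht : t ≠ 0) (hsin : 0 < Real.sin s)
    (htin : Real.sin t < 0) (hst : 0 < Real.sin (t - s)) {A0 A B : L2 →L[ℂ] L2}
    (hA0 : IsSgnQ 0 A0) (hA : IsSgnQ s A) (hB : IsSgnQ t B) (u : L2) :
    (⟪A0 u, (A + B) u⟫_ℂ).re ≤ 8 * Real.log 2 / π * ‖u‖ ^ 2 := by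
  have hd : DenseRange (SchwartzMap.toLpCLM ℂ ℂ 2 (volume : Measure ℝ)) :=
    SchwartzMap.denseRange_toLpCLM (by norm_num)
  refine hd.induction_on u ?_ fun f => ?_
  · exact isClosed_le
      (Complex.continuous_re.comp (A0.continuous.inner (A + B).continuous))
      (continuous_const.mul (continuous_norm.pow 2))
  · change (⟪A0 (f.toLp 2 volume), (A + B) (f.toLp 2 volume)⟫_ℂ).re ≤
      8 * Real.log 2 / π * ‖f.toLp 2 volume‖ ^ 2
    have hp := re_inner_half_le hs ht hsin htin hst hA0 hA hB f (σ := 1) (by norm_num)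
    have hm := re_inner_half_le hs ht hsin htin hst hA0 hA hB f (σ := -1) (by norm_num)
    set v : L2 := f.toLp 2 volume
    have hsymm : ⟪v, (A + B) (A0 v)⟫_ℂ = ⟪(A + B) v, A0 v⟫_ℂ := by
      rw [_root_.add_apply, _root_.add_apply, inner_add_right, inner_add_left, hA.inner_apply,
        hB.inner_apply]
    have hre : (⟪v, (A + B) (A0 v)⟫_ℂ).re = (⟪A0 v, (A + B) v⟫_ℂ).re := by
      rw [hsymm, ← inner_conj_symm, Complex.conj_re]
    have hpar := parallelogram_law_with_norm ℂ v (A0 v)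
    have hn := hA0.norm_apply_le v
    have hn2 : ‖A0 v‖ * ‖A0 v‖ ≤ ‖v‖ * ‖v‖ := mul_self_le_mul_self (norm_nonneg _) hn
    have hθ : 0 ≤ 8 * Real.log 2 / π := by
      have := Real.log_nonneg one_le_two
      positivity
    simp only [Complex.ofReal_one, Complex.ofReal_neg, one_smul, neg_smul, ← sub_eq_add_neg,
      map_add, map_sub, inner_add_left, inner_add_right, inner_sub_left, inner_sub_right,
      Complex.add_re, Complex.sub_re] at hp hm
    have hsum : ‖v + A0 v‖ ^ 2 + ‖v - A0 v‖ ^ 2 ≤ 4 * ‖v‖ ^ 2 := by nlinarith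
    have := mul_le_mul_of_nonneg_left hsum hθ
    linarith

/-- A uniform bound below `3` for three operators `sgn Q` whose angles positively span. -/
lemma opNorm_sgnQ_sum_le {s t : ℝ} (hs : s ≠ 0) (ht : t ≠ 0) (hsin : 0 < Real.sin s)
    (htin : Real.sin t < 0) (hst : 0 < Real.sin (t - s)) {A0 A B : L2 →L[ℂ] L2}
    (hA0 : IsSgnQ 0 A0) (hA : IsSgnQ s A) (hB : IsSgnQ t B) :
    ‖A0 + A + B‖ ≤ 3 - 1 / 20 := by
  refine ContinuousLinearMap.opNorm_le_bound _ (by norm_num) fun u => ?_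
  have hθ : 8 * Real.log 2 / π ≤ 1.8 := by
    rw [div_le_iff₀ Real.pi_pos]
    linarith [Real.log_two_lt_d9, Real.pi_gt_d2]
  have h := re_inner_sgn_sgnQ_add_le hs ht hsin htin hst hA0 hA hB u
  have h0 := hA0.norm_apply_le u
  have h1 : ‖(A + B) u‖ ≤ 2 * ‖u‖ := by
    rw [_root_.add_apply]
    linarith [norm_add_le (A u) (B u), hA.norm_apply_le u, hB.norm_apply_le u]
  have hsq := norm_add_sq (𝕜 := ℂ) (A0 u) ((A + B) u)
  have e : (A0 + A + B) u = A0 u + (A + B) u := by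
    simp only [_root_.add_apply, add_assoc]
  rw [e]
  refine le_of_sq_le_sq ?_ (by positivity)
  rw [hsq]
  have h2 : (RCLike.re ⟪A0 u, (A + B) u⟫_ℂ : ℝ) ≤ 1.8 * ‖u‖ ^ 2 :=
    h.trans (mul_le_mul_of_nonneg_right hθ (sq_nonneg _))
  nlinarith [pow_le_pow_left₀ (norm_nonneg _) h0 2, pow_le_pow_left₀ (norm_nonneg _) h1 2,
    sq_nonneg ‖u‖]


/-- For every `ε > 0` there exists `δ > 0` such that
`‖sgn Q(0) + sgn Q(s) + sgn Q(t)‖ ≤ 3 − δ` for all `s, t` satisfying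
`s ≤ π − ε ≤ t − 2ε ≤ s − 3ε + π`. -/
theorem opNorm_sgnQ_sum_le_uniform (ε : ℝ) (hε : 0 < ε) :
    ∃ δ : ℝ, 0 < δ ∧ ∀ s t : ℝ,
      s ≤ π - ε → π - ε ≤ t - 2 * ε → t - 2 * ε ≤ s - 3 * ε + π →
      ∀ A0 As At : L2 →L[ℂ] L2,
        IsSgnQ 0 A0 → IsSgnQ s As → IsSgnQ t At →
        ‖A0 + As + At‖ ≤ 3 - δ := by
  refine ⟨1 / 20, by norm_num, fun s t h1 h2 h3 A0 As At hA0 hAs hAt => ?_⟩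
  have hs : 0 < Real.sin s := Real.sin_pos_of_pos_of_lt_pi (by linarith) (by linarith)
  have ht : 0 < Real.sin (t - π) := Real.sin_pos_of_pos_of_lt_pi (by linarith) (by linarith)
  rw [Real.sin_sub_pi] at ht
  have hst : 0 < Real.sin (t - s) := Real.sin_pos_of_pos_of_lt_pi (by linarith) (by linarith)
  have hs0 : 0 < s := by linarith
  have ht0 : 0 < t := by linarith [Real.pi_pos]
  exact opNorm_sgnQ_sum_le hs0.ne' ht0.ne' hs (by linarith) hst hA0 hAs hAt
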